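/- arXiv:1412.6037 — 7 statements merged into one kernel-verified Lean document; each statement's English description precedes it below -/
import Mathlib

section
/- The zero modes generate a gl(N) algebra: for all indices i,j,k,l ∈ {1,…,N}, [T_{ij}[0], T_{kl}[0]] = δ_{il}·T_{kj}[0] − δ_{kj}·T_{il}[0]. In particular, for N = 3, [T_{21}[0], T_{12}[0]] = T_{11}[0] − T_{22}[0]. -/
open Filter Topology

theorem aux_alg {R : Type*} [Ring R] [Algebra ℂ R] (c w : ℂ) (hc : c ≠ 0) (hw : w ≠ 0)
    (X Y P1 P2 Q1 Q2 : R) (a b p q : ℂ)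
    (h : X * Y - Y * X = (c / (w - 2 * w)) • (P2 * Q1 - P1 * Q2)) :
    ((w / c) • (X - a • 1)) * ((2 * w / c) • (Y - b • 1))
      - ((2 * w / c) • (Y - b • 1)) * ((w / c) • (X - a • 1))
    = q • ((2 : ℂ) • ((w / c) • (P1 - p • 1)) - (2 * w / c) • (P2 - p • 1))
      - p • ((2 : ℂ) • ((w / c) • (Q1 - q • 1)) - (2 * w / c) • (Q2 - q • 1))
      - (c / w) • (((2 * w / c) • (P2 - p • 1)) * ((w / c) • (Q1 - q • 1))
          - ((w / c) • (P1 - p • 1)) * ((2 * w / c) • (Q2 - q • 1))) := by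
  have h1 : ((w / c) • (X - a • 1)) * ((2 * w / c) • (Y - b • 1))
      - ((2 * w / c) • (Y - b • 1)) * ((w / c) • (X - a • 1))
      = (w / c * (2 * w / c)) • (X * Y - Y * X) := by
    simp only [smul_mul_assoc, mul_smul_comm, sub_mul, mul_sub, one_mul, mul_one]
    module
  have h2 : w - 2 * w = -w := by ring
  rw [h1, h, h2]
  simp only [smul_mul_assoc, mul_smul_comm, sub_mul, mul_sub, one_mul, mul_one]
  match_scalars <;> field_simp <;> ring

/-- The zero modes generate a `gl(N)` algebra: for all indices `i,j,k,l`,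
`[T_{ij}[0], T_{kl}[0]] = δ_{il}·T_{kj}[0] − δ_{kj}·T_{il}[0]`
(in particular, for `N = 3`, `[T_{21}[0], T_{12}[0]] = T_{11}[0] − T_{22}[0]`). -/
theorem zero_modes_glN (c : ℂ) (hc : c ≠ 0) (N : ℕ) (hN : 2 ≤ N)
    (E : Type*) [NormedAddCommGroup E] [NormedSpace ℂ E] [CompleteSpace E]
    (T : Fin N → Fin N → ℂ → E →L[ℂ] E)
    (hRTT : ∀ (i j k l : Fin N) (u v : ℂ), u ≠ v →
      T i j u * T k l v - T k l v * T i j u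
        = (c / (u - v)) • (T k j v * T i l u - T k j u * T i l v))
    (T₀ : Fin N → Fin N → E →L[ℂ] E)
    (hzm : ∀ i j : Fin N,
      Tendsto (fun w : ℂ => (w / c) • (T i j w - if i = j then 1 else 0))
        (comap (‖·‖) atTop) (𝓝 (T₀ i j))) :
    ∀ (i j k l : Fin N),
      T₀ i j * T₀ k l - T₀ k l * T₀ i j
        = (if i = l then T₀ k j else 0) - (if k = j then T₀ i l else 0) := by
  intro i j k l
  have hF : (comap (fun w : ℂ => ‖w‖) atTop) = Bornology.cobounded ℂ := comap_norm_atTop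
  have hz : ∀ i j : Fin N, Tendsto
      (fun w : ℂ => (w / c) • (T i j w - (if i = j then (1 : ℂ) else 0) • (1 : E →L[ℂ] E)))
        (Bornology.cobounded ℂ) (𝓝 (T₀ i j)) := by
    intro i j
    rw [← hF]
    refine (hzm i j).congr fun w => ?_
    split_ifs <;> simp
  have h2 : Tendsto (fun w : ℂ => 2 * w) (Bornology.cobounded ℂ) (Bornology.cobounded ℂ) := by
    rw [← tendsto_norm_atTop_iff_cobounded]
    simp only [norm_mul]
    exact (tendsto_norm_cobounded_atTop).const_mul_atTop (by simp)
  have hz2 := fun i j => (hz i j).comp h2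
  have hinv : Tendsto (fun w : ℂ => c / w) (Bornology.cobounded ℂ) (𝓝 0) := by
    simpa [div_eq_mul_inv] using (tendsto_inv₀_cobounded (α := ℂ)).const_mul c
  have hL := ((hz i j).mul (hz2 k l)).sub ((hz2 k l).mul (hz i j))
  have hR := (((((hz k j).const_smul (2 : ℂ)).sub (hz2 k j)).const_smul
      (if i = l then (1 : ℂ) else 0)).sub
      ((((hz i l).const_smul (2 : ℂ)).sub (hz2 i l)).const_smul
      (if k = j then (1 : ℂ) else 0))).sub
      (hinv.smul (((hz2 k j).mul (hz i l)).sub ((hz k j).mul (hz2 i l))))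
  have hne : ∀ᶠ w : ℂ in Bornology.cobounded ℂ, w ≠ 0 :=
    Bornology.eventually_ne_cobounded 0
  have key := tendsto_nhds_unique_of_eventuallyEq hL hR (by
    filter_upwards [hne] with w hw
    have hww : w ≠ 2 * w := by
      intro h
      apply hw
      linear_combination -h
    exact aux_alg c w hc hw _ _ _ _ _ _ _ _ _ _ (hRTT i j k l w (2 * w) hww))
  rw [key]
  split_ifs <;> module
end

section
/- Summation identity (first identity of the Appendix A Proposition): Σ_{j=1}^{a+1} t(u^C_j, z)·Ω_j = (h(ūB,z)/h(ūC,z))·(f(ūC,z)/f(ūB,z) − 1). -/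
open Finset

lemma pf_aux (a : ℕ) (uC : Fin (a + 1) → ℂ) (uB : Fin a → ℂ) (x : ℂ)
    (huC : Function.Injective uC) (hx : ∀ j, uC j - x ≠ 0) :
    ∑ j, (∏ k ∈ univ.erase j, (uC j - uC k)⁻¹) * (∏ k, (uC j - uB k)) / (uC j - x)
      = (∏ k, (uB k - x)) / ∏ j, (uC j - x) := by
  have hd : (Lagrange.nodal univ uB).degree < #(univ : Finset (Fin (a + 1))) := by
    rw [Lagrange.degree_nodal]
    simp only [card_univ, Fintype.card_fin]
    exact_mod_cast Nat.lt_succ_self a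
  have h := Lagrange.eq_interpolate (s := univ) (v := uC) huC.injOn hd
  have h' := congrArg (Polynomial.eval x) h
  rw [Lagrange.eval_interpolate_not_at_node _
    (fun i _ hxi => hx i (by rw [hxi, sub_self]))] at h'
  simp only [Lagrange.eval_nodal, Lagrange.nodalWeight] at h'
  have hB : ∏ k, (x - uB k) = (-1) ^ a * ∏ k, (uB k - x) := by
    have e : ∏ _k : Fin a, (-1 : ℂ) = (-1) ^ a := by simp
    rw [← e, ← prod_mul_distrib]
    exact prod_congr rfl fun _ _ => by ring
  have hC : ∏ k, (x - uC k) = (-1) ^ (a + 1) * ∏ k, (uC k - x) := by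
    have e : ∏ _k : Fin (a + 1), (-1 : ℂ) = (-1) ^ (a + 1) := by simp
    rw [← e, ← prod_mul_distrib]
    exact prod_congr rfl fun _ _ => by ring
  have hS : ∑ i, (∏ j ∈ univ.erase i, (uC i - uC j)⁻¹) * (x - uC i)⁻¹ * ∏ k, (uC i - uB k)
      = - ∑ j, (∏ k ∈ univ.erase j, (uC j - uC k)⁻¹) * (∏ k, (uC j - uB k)) / (uC j - x) := by
    rw [← sum_neg_distrib]
    refine sum_congr rfl fun i _ => ?_
    rw [← neg_sub (uC i) x, inv_neg]
    ring
  rw [hS, hB, hC, pow_succ] at h'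
  have hn : ((-1 : ℂ)) ^ a ≠ 0 := pow_ne_zero _ (by norm_num)
  rw [eq_div_iff (prod_ne_zero_iff.2 fun j _ => hx j)]
  apply mul_left_cancel₀ hn
  rw [h']
  ring

/-- First summation identity of Appendix A:
`Σ_{j=1}^{a+1} t(u^C_j, z)·Ω_j = (h(ūB,z)/h(ūC,z))·(f(ūC,z)/f(ūB,z) − 1)`,
where `Ω_j = g(u^C_j, ūC∖{u^C_j}) / g(u^C_j, ūB)`, `g(x,y) = c/(x−y)`,
`f(x,y) = (x−y+c)/(x−y)`, `h(x,y) = (x−y+c)/c`, `t(x,y) = c²/((x−y)(x−y+c))`. -/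
theorem summation_identity_one (c : ℂ) (hc : c ≠ 0) (a : ℕ)
    (uC : Fin (a + 1) → ℂ) (uB : Fin a → ℂ) (z : ℂ)
    (huC : Function.Injective uC)
    (hCB : ∀ j k, uC j ≠ uB k)
    (h1 : ∀ j, uC j - z ≠ 0)
    (h2 : ∀ j, uC j - z + c ≠ 0)
    (h3 : ∀ k, uB k - z ≠ 0)
    (h4 : ∀ k, uB k - z + c ≠ 0) :
    ∑ j, (c ^ 2 / ((uC j - z) * (uC j - z + c))) *
        ((∏ k ∈ univ.erase j, c / (uC j - uC k)) / ∏ k, c / (uC j - uB k))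
      = ((∏ k, (uB k - z + c) / c) / ∏ j, (uC j - z + c) / c) *
        ((∏ j, (uC j - z + c) / (uC j - z)) /
          (∏ k, (uB k - z + c) / (uB k - z)) - 1) := by
  have e1 := pf_aux a uC uB z huC h1
  have e2 := pf_aux a uC uB (z - c) huC (fun j => by rw [← sub_add]; exact h2 j)
  simp only [← sub_add] at e2
  have hL : ∀ j, (c ^ 2 / ((uC j - z) * (uC j - z + c))) *
        ((∏ k ∈ univ.erase j, c / (uC j - uC k)) / ∏ k, c / (uC j - uB k))
      = c * ((∏ k ∈ univ.erase j, (uC j - uC k)⁻¹) * (∏ k, (uC j - uB k)) / (uC j - z)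
        - (∏ k ∈ univ.erase j, (uC j - uC k)⁻¹) * (∏ k, (uC j - uB k)) / (uC j - z + c)) := by
    intro j
    have q1 : ∏ k ∈ univ.erase j, c / (uC j - uC k)
        = c ^ a * ∏ k ∈ univ.erase j, (uC j - uC k)⁻¹ := by
      simp only [div_eq_mul_inv, prod_mul_distrib, prod_const]
      simp
    have q2 : ∏ k, c / (uC j - uB k) = c ^ a / ∏ k, (uC j - uB k) := by
      simp [prod_div_distrib]
    rw [q1, q2]
    have := h1 j
    have := h2 j
    have : ∏ k, (uC j - uB k) ≠ 0 := prod_ne_zero_iff.2 fun k _ => sub_ne_zero.2 (hCB j k)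
    generalize ∏ k ∈ univ.erase j, (uC j - uC k)⁻¹ = A
    field_simp
    ring
  rw [sum_congr rfl fun j _ => hL j, ← mul_sum, sum_sub_distrib, e1, e2]
  have n1 : ∏ j, (uC j - z) ≠ 0 := prod_ne_zero_iff.2 fun j _ => h1 j
  have n2 : ∏ j, (uC j - z + c) ≠ 0 := prod_ne_zero_iff.2 fun j _ => h2 j
  have n3 : ∏ j, (uB j - z) ≠ 0 := prod_ne_zero_iff.2 fun j _ => h3 j
  have n4 : ∏ j, (uB j - z + c) ≠ 0 := prod_ne_zero_iff.2 fun j _ => h4 j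
  simp only [prod_div_distrib, prod_const, card_univ, Fintype.card_fin]
  field_simp
  ring
end

section
/- Summation identity (second identity of the Appendix A Proposition): Σ_{j=1}^{a+1} t(z, u^C_j)·Ω_j = (h(z,ūB)/h(z,ūC))·(f(z,ūC)/f(z,ūB) − 1). -/
open Finset

theorem aux_pf (a : ℕ) (uC : Fin (a + 1) → ℂ) (uB : Fin a → ℂ) (w : ℂ)
    (huC : Function.Injective uC) (h1 : ∀ j, w - uC j ≠ 0) :
    ∑ j, (∏ k, (uC j - uB k)) / (∏ k ∈ univ.erase j, (uC j - uC k)) / (w - uC j)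
      = (∏ k, (w - uB k)) / ∏ j, (w - uC j) := by
  have hC : ∏ j, (w - uC j) ≠ 0 := prod_ne_zero_iff.mpr fun j _ => h1 j
  have hd : (Lagrange.nodal univ uB).degree < #(univ : Finset (Fin (a + 1))) := by
    rw [Lagrange.degree_nodal]
    simp only [card_univ, Fintype.card_fin]
    exact_mod_cast Nat.lt_succ_self a
  have e := congrArg (Polynomial.eval w)
    (Lagrange.eq_interpolate (s := univ) (v := uC) huC.injOn hd)
  rw [Lagrange.eval_interpolate_not_at_node _ (fun i _ => sub_ne_zero.mp (h1 i))] at e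
  simp only [Lagrange.eval_nodal, Lagrange.nodalWeight] at e
  rw [e, mul_div_cancel_left₀ _ hC]
  refine sum_congr rfl fun j _ => ?_
  rw [prod_inv_distrib]
  ring

/-- Second summation identity of Appendix A:
`Σ_{j=1}^{a+1} t(z, u^C_j)·Ω_j = (h(z,ūB)/h(z,ūC))·(f(z,ūC)/f(z,ūB) − 1)`,
where `Ω_j = g(u^C_j, ūC∖{u^C_j}) / g(u^C_j, ūB)`, `g(x,y) = c/(x−y)`,
`f(x,y) = (x−y+c)/(x−y)`, `h(x,y) = (x−y+c)/c`, `t(x,y) = c²/((x−y)(x−y+c))`. -/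
theorem summation_identity_two (c : ℂ) (hc : c ≠ 0) (a : ℕ)
    (uC : Fin (a + 1) → ℂ) (uB : Fin a → ℂ) (z : ℂ)
    (huC : Function.Injective uC)
    (hCB : ∀ j k, uC j ≠ uB k)
    (h1 : ∀ j, z - uC j ≠ 0)
    (h2 : ∀ j, z - uC j + c ≠ 0)
    (h3 : ∀ k, z - uB k ≠ 0)
    (h4 : ∀ k, z - uB k + c ≠ 0) :
    ∑ j, (c ^ 2 / ((z - uC j) * (z - uC j + c))) *
        ((∏ k ∈ univ.erase j, c / (uC j - uC k)) / ∏ k, c / (uC j - uB k))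
      = ((∏ k, (z - uB k + c) / c) / ∏ j, (z - uC j + c) / c) *
        ((∏ j, (z - uC j + c) / (z - uC j)) /
          (∏ k, (z - uB k + c) / (z - uB k)) - 1) := by
  have hB := fun j : Fin (a+1) => (prod_ne_zero_iff.mpr fun k _ => sub_ne_zero.mpr (hCB j k) :
    ∏ k, (uC j - uB k) ≠ 0)
  have p1 : ∏ j, (z - uC j) ≠ 0 := prod_ne_zero_iff.mpr fun j _ => h1 j
  have p2 : ∏ j, (z - uC j + c) ≠ 0 := prod_ne_zero_iff.mpr fun j _ => h2 j
  have p3 : ∏ j, (z - uB j) ≠ 0 := prod_ne_zero_iff.mpr fun j _ => h3 j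
  have p4 : ∏ j, (z - uB j + c) ≠ 0 := prod_ne_zero_iff.mpr fun j _ => h4 j
  have e1 := aux_pf a uC uB z huC h1
  have hs : ∀ x, z + c - x = z - x + c := fun x => by ring
  have e2 := aux_pf a uC uB (z + c) huC (fun j => by rw [hs]; exact h2 j)
  simp only [hs] at e2
  have hR : ((∏ k, (z - uB k + c) / c) / ∏ j, (z - uC j + c) / c) *
        ((∏ j, (z - uC j + c) / (z - uC j)) /
          (∏ k, (z - uB k + c) / (z - uB k)) - 1) =
      c * ((∏ k, (z - uB k)) / (∏ j, (z - uC j))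
        - (∏ k, (z - uB k + c)) / ∏ j, (z - uC j + c)) := by
    simp only [prod_div_distrib, prod_const, card_univ, Fintype.card_fin]
    rw [pow_succ]
    field_simp
  rw [hR, ← e1, ← e2, ← sum_sub_distrib, mul_sum]
  refine sum_congr rfl fun j _ => ?_
  have hE : ∏ k ∈ univ.erase j, (uC j - uC k) ≠ 0 := prod_ne_zero_iff.mpr fun k hk =>
    sub_ne_zero.mpr fun h => (mem_erase.mp hk).1 (huC h).symm
  have hBj := hB j
  have a1 := h1 j
  have a2 := h2 j
  simp only [prod_div_distrib, prod_const, card_univ, Fintype.card_fin,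
    card_erase_of_mem (mem_univ j), Nat.add_sub_cancel]
  generalize ∏ k ∈ univ.erase j, (uC j - uC k) = E at *
  generalize ∏ k, (uC j - uB k) = F at *
  have : c ^ a ≠ 0 := pow_ne_zero _ hc
  field_simp
  ring
end

section
/- Summation identity (third identity of the Appendix A Proposition): Σ_{j=1}^{b} t(v^B_j, z)·Ω'_j = (h(v̄C,z)/h(v̄B,z))·(1 − f(v̄B,z)/f(v̄C,z)) − 1. -/
open Finset

theorem aux_erase {ι : Type*} [Fintype ι] [DecidableEq ι] (i : ι) (F : ι → ℂ) :
    ∏ j ∈ univ.erase i, F j = ∏ j, if j = i then 1 else F j := by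
  rw [← Finset.mul_prod_erase univ (fun j => if j = i then 1 else F j) (mem_univ i)]
  simp only [if_true, one_mul]
  refine Finset.prod_congr rfl fun j hj => ?_
  rw [if_neg (Finset.ne_of_mem_erase hj)]

theorem aux_lagrange (b : ℕ) (vB : Fin b → ℂ) (vC : Fin (b + 1) → ℂ) (p q : ℂ)
    (hvB : Function.Injective vB) (hp : ∀ j, vB j ≠ p) (hq : ∀ j, vB j ≠ q) (hpq : p ≠ q) :
    (1 : ℂ) = (∏ k, (p - vC k)) / ((p - q) * ∏ j, (p - vB j))
      + ((∏ k, (q - vC k)) / ((q - p) * ∏ j, (q - vB j))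
      + ∑ j, (∏ k, (vB j - vC k)) /
          ((vB j - p) * ((vB j - q) * ∏ k ∈ univ.erase j, (vB j - vB k)))) := by
  classical
  let v : Option (Option (Fin b)) → ℂ := fun o =>
    o.elim p (fun o' => o'.elim q vB)
  have hv : Function.Injective v := by
    rintro (_ | _ | i) (_ | _ | j) h
    · rfl
    · exact absurd h hpq
    · exact absurd h.symm (hp j)
    · exact absurd h.symm hpq
    · rfl
    · exact absurd h.symm (hq j)
    · exact absurd h (hp i)
    · exact absurd h (hq i)
    · rw [hvB h]
  have hm : (∏ k, (Polynomial.X - Polynomial.C (vC k))).Monic :=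
    Polynomial.monic_prod_of_monic _ _ fun k _ => Polynomial.monic_X_sub_C _
  have hd : (∏ k, (Polynomial.X - Polynomial.C (vC k))).degree = ((b + 1 : ℕ) : WithBot ℕ) := by
    rw [Polynomial.degree_prod]; simp
  have key := Lagrange.leadingCoeff_eq_sum (s := univ) (v := v) hv.injOn
    (P := ∏ k, (Polynomial.X - Polynomial.C (vC k))) (by rw [hd]; simp)
  rw [hm.leadingCoeff] at key
  rw [key]
  simp only [aux_erase, Fintype.sum_option, Fintype.prod_option, Polynomial.eval_prod]
  simp [v]

/-- Third summation identity of Appendix A: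
`Σ_{j=1}^{b} t(v^B_j, z)·Ω'_j = (h(v̄C,z)/h(v̄B,z))·(1 − f(v̄B,z)/f(v̄C,z)) − 1`,
where `Ω'_j = −g(v^B_j, v̄B∖{v^B_j}) / g(v^B_j, v̄C)`, `g(x,y) = c/(x−y)`,
`f(x,y) = (x−y+c)/(x−y)`, `h(x,y) = (x−y+c)/c`, `t(x,y) = c²/((x−y)(x−y+c))`. -/
theorem summation_identity_three (c : ℂ) (hc : c ≠ 0) (b : ℕ)
    (vB : Fin b → ℂ) (vC : Fin (b + 1) → ℂ) (z : ℂ)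
    (hvB : Function.Injective vB)
    (hBC : ∀ j k, vB j ≠ vC k)
    (h1 : ∀ j, vB j - z ≠ 0)
    (h2 : ∀ j, vB j - z + c ≠ 0)
    (h3 : ∀ k, vC k - z ≠ 0)
    (h4 : ∀ k, vC k - z + c ≠ 0) :
    ∑ j, (c ^ 2 / ((vB j - z) * (vB j - z + c))) *
        (-((∏ k ∈ univ.erase j, c / (vB j - vB k)) / ∏ k, c / (vB j - vC k)))
      = ((∏ k, (vC k - z + c) / c) / ∏ j, (vB j - z + c) / c) *
        (1 - (∏ j, (vB j - z + c) / (vB j - z)) /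
          ∏ k, (vC k - z + c) / (vC k - z)) - 1 := by
  have key := aux_lagrange b vB vC z (z - c) hvB (fun j => sub_ne_zero.1 (h1 j))
    (fun j h => h2 j (by rw [h]; ring)) (fun h => hc (by linear_combination h))
  have hB1 : ∏ j, (z - vB j) = (-1) ^ b * ∏ j, (vB j - z) := by
    have : ∀ j, z - vB j = (-1) * (vB j - z) := fun j => by ring
    simp only [this, Finset.prod_mul_distrib, Finset.prod_const, Finset.card_univ, Fintype.card_fin]
  have hB2 : ∏ j, (z - c - vB j) = (-1) ^ b * ∏ j, (vB j - z + c) := by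
    have : ∀ j, z - c - vB j = (-1) * (vB j - z + c) := fun j => by ring
    simp only [this, Finset.prod_mul_distrib, Finset.prod_const, Finset.card_univ, Fintype.card_fin]
  have hC1 : ∏ j, (z - vC j) = (-1) ^ (b + 1) * ∏ j, (vC j - z) := by
    have : ∀ j, z - vC j = (-1) * (vC j - z) := fun j => by ring
    simp only [this, Finset.prod_mul_distrib, Finset.prod_const, Finset.card_univ, Fintype.card_fin]
  have hC2 : ∏ j, (z - c - vC j) = (-1) ^ (b + 1) * ∏ j, (vC j - z + c) := by
    have : ∀ j, z - c - vC j = (-1) * (vC j - z + c) := fun j => by ring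
    simp only [this, Finset.prod_mul_distrib, Finset.prod_const, Finset.card_univ, Fintype.card_fin]
  rw [hB1, hB2, hC1, hC2] at key
  have hS : ∑ j, (c ^ 2 / ((vB j - z) * (vB j - z + c))) *
        (-((∏ k ∈ univ.erase j, c / (vB j - vB k)) / ∏ k, c / (vB j - vC k)))
      = -∑ j, (∏ k, (vB j - vC k)) /
          ((vB j - z) * ((vB j - (z - c)) * ∏ k ∈ univ.erase j, (vB j - vB k))) := by
    rw [← Finset.sum_neg_distrib]
    refine Finset.sum_congr rfl fun j _ => ?_
    have e1 : ∏ k ∈ univ.erase j, (vB j - vB k) ≠ 0 :=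
      Finset.prod_ne_zero_iff.2 fun k hk =>
        sub_ne_zero.2 fun h => Finset.ne_of_mem_erase hk (hvB h).symm
    have e2 : ∏ k, (vB j - vC k) ≠ 0 :=
      Finset.prod_ne_zero_iff.2 fun k _ => sub_ne_zero.2 (hBC j k)
    have e3 : vB j - (z - c) = vB j - z + c := by ring
    have e4 : c ^ (b + 1) = c ^ 2 * c ^ (univ.erase j).card := by
      rw [Finset.card_erase_of_mem (mem_univ j), Finset.card_univ, Fintype.card_fin, ← pow_add]
      congr 1
      have := j.pos
      omega
    have := h1 j
    have := h2 j
    rw [e3, Finset.prod_div_distrib, Finset.prod_div_distrib, Finset.prod_const, Finset.prod_const,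
      Finset.card_univ, Fintype.card_fin, e4]
    generalize ∏ k ∈ univ.erase j, (vB j - vB k) = E at *
    generalize ∏ k, (vB j - vC k) = G at *
    field_simp
  rw [hS]
  simp only [Finset.prod_div_distrib, Finset.prod_const, Finset.card_univ, Fintype.card_fin]
  have n1 := Finset.prod_ne_zero_iff.2 fun j (_ : j ∈ univ) => h1 j
  have n2 := Finset.prod_ne_zero_iff.2 fun j (_ : j ∈ univ) => h2 j
  have n3 := Finset.prod_ne_zero_iff.2 fun j (_ : j ∈ univ) => h3 j
  have n4 := Finset.prod_ne_zero_iff.2 fun j (_ : j ∈ univ) => h4 j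
  generalize (∑ j, (∏ k, (vB j - vC k)) /
          ((vB j - z) * ((vB j - (z - c)) * ∏ k ∈ univ.erase j, (vB j - vB k)))) = S at *
  generalize ∏ j, (vB j - z) = A at *
  generalize ∏ j, (vB j - z + c) = A' at *
  generalize ∏ j, (vC j - z) = B at *
  generalize ∏ j, (vC j - z + c) = B' at *
  have hs : ((-1 : ℂ)) ^ b ≠ 0 := pow_ne_zero _ (by norm_num)
  have k1 : (-1 : ℂ) ^ (b + 1) * B / ((z - (z - c)) * ((-1) ^ b * A)) = - (B / (c * A)) := by
    rw [pow_succ, sub_sub_cancel]; field_simp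
  have k2 : (-1 : ℂ) ^ (b + 1) * B' / ((z - c - z) * ((-1) ^ b * A')) = B' / (c * A') := by
    rw [pow_succ, show z - c - z = -c by ring]; field_simp
  rw [k1, k2] at key
  have k3 : B' / c ^ (b + 1) / (A' / c ^ b) * (1 - A' / A / (B' / B))
      = B' / (c * A') - B / (c * A) := by
    rw [pow_succ]; field_simp
  rw [k3]
  linear_combination key
end

section
/- Summation identity (fourth identity of the Appendix A Proposition): Σ_{j=1}^{b} t(z, v^B_j)·Ω'_j = (h(z,v̄C)/h(z,v̄B))·(1 − f(z,v̄B)/f(z,v̄C)) − 1. -/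
open Finset

lemma key_pf (b : ℕ) (vB : Fin b → ℂ) (vC : Fin (b + 1) → ℂ)
    (hvB : Function.Injective vB) :
    ∃ a : ℂ, ∀ x : ℂ, (∀ j, x - vB j ≠ 0) →
      (∏ k, (x - vC k)) / (∏ j, (x - vB j)) = x + a +
        ∑ j, (∏ k ∈ univ.erase j, (vB j - vB k)⁻¹) * (x - vB j)⁻¹ * ∏ k, (vB j - vC k) := by
  classical
  set P := Lagrange.nodal univ vC with hP
  set Q := Lagrange.nodal univ vB with hQ
  have hPm : P.Monic := Lagrange.nodal_monic
  have hQm : Q.Monic := Lagrange.nodal_monic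
  have hPd : P.natDegree = b + 1 := by simp [hP]
  have hQd : Q.natDegree = b := by simp [hQ]
  have hdeg : Q.degree ≤ P.degree := by
    rw [hP, hQ, Lagrange.degree_nodal, Lagrange.degree_nodal]
    simp only [card_univ, Fintype.card_fin]
    exact_mod_cast Nat.le_succ b
  have hm : (P /ₘ Q).Monic := by
    rw [Polynomial.Monic, Polynomial.leadingCoeff_divByMonic_of_monic hQm hdeg]
    exact hPm
  have hd : (P /ₘ Q).natDegree = 1 := by
    rw [Polynomial.natDegree_divByMonic _ hQm, hPd, hQd]; omega
  have hX := hm.eq_X_add_C hd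
  have hdecomp := Polynomial.modByMonic_add_div P Q
  have hR : (P %ₘ Q).degree < ((univ : Finset (Fin b)).card : WithBot ℕ) := by
    have := Polynomial.degree_modByMonic_lt P hQm
    rwa [hQ, Lagrange.degree_nodal] at this
  have hI := Lagrange.eq_interpolate (s := univ) (v := vB) hvB.injOn hR
  refine ⟨(P /ₘ Q).coeff 0, fun x hx => ?_⟩
  have hQx : ∀ y, Q.eval y = ∏ j, (y - vB j) := fun y => Lagrange.eval_nodal
  have hPx : ∀ y, P.eval y = ∏ j, (y - vC j) := fun y => Lagrange.eval_nodal
  have hne : Q.eval x ≠ 0 := by rw [hQx]; exact prod_ne_zero_iff.2 fun j _ => hx j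
  have hv : ∀ j, (P %ₘ Q).eval (vB j) = ∏ k, (vB j - vC k) := by
    intro j
    have h0 : Q.eval (vB j) = 0 := Lagrange.eval_nodal_at_node (mem_univ j)
    have := congrArg (Polynomial.eval (vB j)) hdecomp
    rw [Polynomial.eval_add, Polynomial.eval_mul, h0, zero_mul, add_zero] at this
    rw [this, hPx]
  have hRx := Lagrange.eval_interpolate_not_at_node (s := univ) (v := vB) (x := x)
    (fun i => (P %ₘ Q).eval (vB i)) (fun i _ => sub_ne_zero.1 (hx i))
  rw [← hI, ← hQ] at hRx
  have h := congrArg (Polynomial.eval x) hdecomp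
  rw [Polynomial.eval_add, Polynomial.eval_mul, hRx, hX] at h
  simp only [hv, Lagrange.nodalWeight, Polynomial.eval_add, Polynomial.eval_X,
    Polynomial.eval_C] at h
  rw [← hPx, ← hQx, div_eq_iff hne, ← h]
  ring

/-- Fourth summation identity of Appendix A:
`Σ_{j=1}^{b} t(z, v^B_j)·Ω'_j = (h(z,v̄C)/h(z,v̄B))·(1 − f(z,v̄B)/f(z,v̄C)) − 1`,
where `Ω'_j = −g(v^B_j, v̄B∖{v^B_j}) / g(v^B_j, v̄C)`, `g(x,y) = c/(x−y)`,
`f(x,y) = (x−y+c)/(x−y)`, `h(x,y) = (x−y+c)/c`, `t(x,y) = c²/((x−y)(x−y+c))`. -/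
theorem summation_identity_four (c : ℂ) (hc : c ≠ 0) (b : ℕ)
    (vB : Fin b → ℂ) (vC : Fin (b + 1) → ℂ) (z : ℂ)
    (hvB : Function.Injective vB)
    (hBC : ∀ j k, vB j ≠ vC k)
    (h1 : ∀ j, z - vB j ≠ 0)
    (h2 : ∀ j, z - vB j + c ≠ 0)
    (h3 : ∀ k, z - vC k ≠ 0)
    (h4 : ∀ k, z - vC k + c ≠ 0) :
    ∑ j, (c ^ 2 / ((z - vB j) * (z - vB j + c))) *
        (-((∏ k ∈ univ.erase j, c / (vB j - vB k)) / ∏ k, c / (vB j - vC k)))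
      = ((∏ k, (z - vC k + c) / c) / ∏ j, (z - vB j + c) / c) *
        (1 - (∏ j, (z - vB j + c) / (z - vB j)) /
          ∏ k, (z - vC k + c) / (z - vC k)) - 1 := by
  obtain ⟨a, ha⟩ := key_pf b vB vC hvB
  have e1 := ha z h1
  have e2 := ha (z + c) (fun j => by have := h2 j; rwa [sub_add_eq_add_sub] at this)
  have hB1 : ∏ j, (z - vB j) ≠ 0 := prod_ne_zero_iff.2 fun j _ => h1 j
  have hB2 : ∏ j, (z - vB j + c) ≠ 0 := prod_ne_zero_iff.2 fun j _ => h2 j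
  have hC1 : ∏ j, (z - vC j) ≠ 0 := prod_ne_zero_iff.2 fun j _ => h3 j
  have hC2 : ∏ j, (z - vC j + c) ≠ 0 := prod_ne_zero_iff.2 fun j _ => h4 j
  simp only [← sub_add_eq_add_sub] at e2
  have hr : ((∏ k, (z - vC k + c) / c) / ∏ j, (z - vB j + c) / c) *
        (1 - (∏ j, (z - vB j + c) / (z - vB j)) /
          ∏ k, (z - vC k + c) / (z - vC k)) - 1 =
      c⁻¹ * ((∏ k, (z - vC k + c)) / (∏ j, (z - vB j + c)) -
        (∏ k, (z - vC k)) / (∏ j, (z - vB j))) - 1 := by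
    simp only [prod_div_distrib, prod_const, card_univ, Fintype.card_fin]
    field_simp
    ring
  rw [hr, e1, e2, add_sub_add_comm, ← sum_sub_distrib, mul_add, mul_sum]
  have : c⁻¹ * (z + c + a - (z + a)) = 1 := by field_simp; ring
  rw [this, add_sub_cancel_left]
  refine sum_congr rfl fun j _ => ?_
  have hcard : (univ.erase j).card + 1 = b := by
    rw [card_erase_add_one (mem_univ j)]; simp
  have hcp : c ^ (b + 1) = c ^ (univ.erase j).card * c ^ 2 := by
    rw [← pow_add]; congr 1; omega
  have hP : ∏ k, (vB j - vC k) ≠ 0 := prod_ne_zero_iff.2 fun k _ => sub_ne_zero.2 (hBC j k)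
  have hQ : ∏ k ∈ univ.erase j, (vB j - vB k) ≠ 0 := prod_ne_zero_iff.2 fun k hk =>
    sub_ne_zero.2 fun h => (ne_of_mem_erase hk) (hvB h).symm
  have g1 := h1 j
  have g2 := h2 j
  simp only [prod_div_distrib, prod_const, prod_inv_distrib]
  rw [card_univ, Fintype.card_fin, hcp]
  generalize (univ.erase j).card = n
  generalize ∏ k, (vB j - vC k) = A at *
  generalize ∏ k ∈ univ.erase j, (vB j - vB k) = B at *
  generalize z - vB j = w at *
  field_simp
  ring
end

section
/- Full summation formula for the matrix N^{(1,3)}: Σ_{j=1}^{a+b+1} Ω_j·N_j(x) = (τ(x|ūC,v̄C) − τ(x|ūB,v̄B)) / (f(x,ūB)·f(v̄C,x)) − Φ(x). -/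
open Finset

open Polynomial in
theorem pf_aux_s9 {n : ℕ} (u : Fin n → ℂ) (hu : Function.Injective u) (p : Polynomial ℂ)
    (hp : p.degree < n) (z : ℂ) (hz : ∀ j, z - u j ≠ 0) :
    ∑ j, (p.eval (u j) / ∏ k ∈ univ.erase j, (u j - u k)) / (z - u j)
      = p.eval z / ∏ k, (z - u k) := by
  have h1 := Lagrange.eq_interpolate (s := univ) (v := u) (f := p) hu.injOn (by simpa using hp)
  have h2 := Lagrange.eval_interpolate_not_at_node (s := univ) (v := u) (x := z)
    (fun i => p.eval (u i)) (fun i _ => sub_ne_zero.1 (hz i))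
  rw [← h1, Lagrange.eval_nodal] at h2
  rw [h2, mul_div_cancel_left₀ _ (prod_ne_zero_iff.2 fun k _ => hz k)]
  refine sum_congr rfl fun j _ => ?_
  rw [Lagrange.nodalWeight, prod_inv_distrib]
  ring

theorem pf_one {a : ℕ} (u : Fin (a+1) → ℂ) (w : Fin a → ℂ) (hu : Function.Injective u)
    (z : ℂ) (hz : ∀ j, z - u j ≠ 0) :
    ∑ j, ((∏ k, (u j - w k)) / ∏ k ∈ univ.erase j, (u j - u k)) / (z - u j)
      = (∏ k, (z - w k)) / ∏ k, (z - u k) := by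
  have := pf_aux_s9 u hu (Lagrange.nodal univ w)
    (by rw [Lagrange.degree_nodal]; simp; exact_mod_cast Nat.lt_succ_self a) z hz
  simpa only [Lagrange.eval_nodal] using this

open Polynomial in
theorem pf_two {b : ℕ} (u : Fin b → ℂ) (w : Fin (b+1) → ℂ) (hu : Function.Injective u) :
    ∃ d : ℂ, ∀ z : ℂ, (∀ j, z - u j ≠ 0) →
    ∑ j, ((∏ k, (u j - w k)) / ∏ k ∈ univ.erase j, (u j - u k)) / (z - u j)
      = (∏ k, (z - w k)) / (∏ k, (z - u k)) - z - d := by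
  set R : ℂ[X] := Lagrange.nodal univ w with hR
  set S : ℂ[X] := Lagrange.nodal univ u with hS
  have hSm : S.Monic := Lagrange.nodal_monic
  have hRm : R.Monic := Lagrange.nodal_monic
  have hRd : R.natDegree = b + 1 := by simp [hR]
  have hSd : S.natDegree = b := by simp [hS]
  have hq : (R /ₘ S).natDegree = 1 := by
    rw [natDegree_divByMonic _ hSm, hRd, hSd]; omega
  have hlc : (R /ₘ S).leadingCoeff = 1 := by
    rw [leadingCoeff_divByMonic_of_monic hSm, hRm.leadingCoeff]
    rw [degree_eq_natDegree hSm.ne_zero, degree_eq_natDegree hRm.ne_zero, hRd, hSd]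
    exact_mod_cast Nat.le_succ b
  have hqe : R /ₘ S = X + C ((R /ₘ S).coeff 0) := by
    have := Monic.eq_X_add_C (p := R /ₘ S) hlc hq
    exact this
  have hdec := modByMonic_add_div R S
  refine ⟨(R /ₘ S).coeff 0, fun z hz => ?_⟩
  have hdeg : (R %ₘ S).degree < b := by
    have := degree_modByMonic_lt R hSm
    rwa [degree_eq_natDegree hSm.ne_zero, hSd] at this
  have h := pf_aux_s9 u hu (R %ₘ S) hdeg z hz
  have he : ∀ y, (R %ₘ S).eval y
      = (∏ k, (y - w k)) - (∏ k, (y - u k)) * (y + (R /ₘ S).coeff 0) := by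
    intro y
    have h3 := congrArg (Polynomial.eval y) hdec
    have h4 := congrArg (Polynomial.eval y) hqe
    rw [eval_add, eval_mul, hR, hS, Lagrange.eval_nodal, Lagrange.eval_nodal, ← hR, ← hS] at h3
    rw [eval_add, eval_X, eval_C] at h4
    rw [← h3, ← h4]; ring
  have hne : ∏ k, (z - u k) ≠ 0 := prod_ne_zero_iff.2 fun k _ => hz k
  have hnode : ∀ j, (R %ₘ S).eval (u j) = ∏ k, (u j - w k) := by
    intro j
    rw [he, prod_eq_zero (f := fun k => u j - u k) (mem_univ j) (sub_self _)]; ring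
  simp only [hnode] at h
  rw [h, he]
  field_simp
  ring

theorem t_left {n : ℕ} (c x : ℂ) (u ω : Fin n → ℂ)
    (h1 : ∀ j, u j - x ≠ 0) (h2 : ∀ j, u j - x + c ≠ 0) :
    ∑ j, ω j * (c ^ 2 / ((u j - x) * (u j - x + c)))
      = c * (∑ j, ω j / (x - c - u j) - ∑ j, ω j / (x - u j)) := by
  rw [← sum_sub_distrib, mul_sum]
  refine sum_congr rfl fun j _ => ?_
  rw [show x - c - u j = -(u j - x + c) by ring, show x - u j = -(u j - x) by ring]
  have := h1 j
  have := h2 j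
  field_simp
  ring

theorem t_right {n : ℕ} (c x : ℂ) (u ω : Fin n → ℂ)
    (h1 : ∀ j, u j - x ≠ 0) (h2 : ∀ j, x - u j + c ≠ 0) :
    ∑ j, ω j * (c ^ 2 / ((x - u j) * (x - u j + c)))
      = c * (∑ j, ω j / (x - u j) - ∑ j, ω j / (x + c - u j)) := by
  rw [← sum_sub_distrib, mul_sum]
  refine sum_congr rfl fun j _ => ?_
  rw [show x + c - u j = (x - u j + c) by ring]
  have : x - u j ≠ 0 := by
    intro h; apply h1 j; rw [← neg_sub, h, neg_zero]
  have := h2 j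
  field_simp
  ring

theorem om_u {a : ℕ} (c : ℂ) (hc : c ≠ 0) (u : Fin (a+1) → ℂ) (w : Fin a → ℂ) (j : Fin (a+1)) :
    (∏ k ∈ univ.erase j, c / (u j - u k)) / ∏ k, c / (u j - w k)
      = (∏ k, (u j - w k)) / ∏ k ∈ univ.erase j, (u j - u k) := by
  rw [prod_div_distrib, prod_div_distrib]
  simp only [prod_const, card_erase_of_mem (mem_univ j), card_univ, Fintype.card_fin,
    Nat.add_sub_cancel]
  have : c ^ a ≠ 0 := pow_ne_zero _ hc
  rw [div_div_div_eq, mul_comm (∏ k ∈ univ.erase j, (u j - u k)), mul_div_mul_left _ _ this]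

theorem om_v {b : ℕ} (c : ℂ) (hc : c ≠ 0) (u : Fin b → ℂ) (w : Fin (b+1) → ℂ) (j : Fin b) :
    -((∏ k ∈ univ.erase j, c / (u j - u k)) / ∏ k, c / (u j - w k))
      = -(1/c^2) * ((∏ k, (u j - w k)) / ∏ k ∈ univ.erase j, (u j - u k)) := by
  rw [prod_div_distrib, prod_div_distrib]
  simp only [prod_const, card_erase_of_mem (mem_univ j), card_univ, Fintype.card_fin]
  obtain ⟨m, rfl⟩ : ∃ m, b = m + 1 := ⟨b - 1, by have := j.pos; omega⟩
  have : c ^ m ≠ 0 := pow_ne_zero _ hc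
  rw [Nat.add_sub_cancel, div_div_div_eq, pow_succ, pow_succ]
  rw [show c ^ m * (∏ k, (u j - w k)) / ((∏ k ∈ univ.erase j, (u j - u k)) * (c ^ m * c * c))
    = c ^ m * (∏ k, (u j - w k)) / (c^m * ((∏ k ∈ univ.erase j, (u j - u k)) * c^2)) by ring_nf,
    mul_div_mul_left _ _ this, ← div_div]
  ring

theorem pneg {n : ℕ} (u : Fin n → ℂ) (x : ℂ) :
    ∏ k, (u k - x) = (-1)^n * ∏ k, (x - u k) := by
  rw [show (fun k => u k - x) = fun k => (-1) * (x - u k) by funext k; ring,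
    prod_mul_distrib]
  simp

theorem pnegc {n : ℕ} (u : Fin n → ℂ) (x c : ℂ) :
    ∏ k, (u k - x + c) = (-1)^n * ∏ k, (x - c - u k) := by
  rw [← pneg]; exact prod_congr rfl fun k _ => by ring

theorem pposc {n : ℕ} (u : Fin n → ℂ) (x c : ℂ) :
    ∏ k, (x - u k + c) = ∏ k, (x + c - u k) :=
  prod_congr rfl fun k _ => by ring

/-- Full summation formula for the matrix `N^{(1,3)}`:
`Σ_{j=1}^{a+b+1} Ω_j·N_j(x) = (τ(x|ūC,v̄C) − τ(x|ūB,v̄B)) / (f(x,ūB)·f(v̄C,x)) − Φ(x)`.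
Here `g(x,y) = c/(x−y)`, `f(x,y) = (x−y+c)/(x−y)`, `h(x,y) = (x−y+c)/c`,
`t(x,y) = c²/((x−y)(x−y+c))`; `Ω_j = g(u^C_j,ūC∖{u^C_j})/g(u^C_j,ūB)` for `j ≤ a+1` and
`Ω_{a+1+j} = −g(v^B_j,v̄B∖{v^B_j})/g(v^B_j,v̄C)`;
`N_j(x) = t(u^C_j,x)·(−1)^a·ρ₁·h(ūC,x)/(f(v̄C,x)·h(x,ūB)) + t(x,u^C_j)·h(x,ūC)/h(x,ūB)` and
`N_{a+1+j}(x) = t(x,v^B_j)·(−1)^{b−1}·ρ₃·h(x,v̄B)/(f(x,ūB)·h(v̄C,x)) + t(v^B_j,x)·h(v̄B,x)/h(v̄C,x)`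
(with `(−1)^{b−1}` written as `(−1)^{b+1}`, equal for all integers `b`);
`Φ(x) = (−1)^{b−1}·ρ₃·h(x,v̄B)/(f(x,ūB)·h(v̄C,x)) + h(v̄B,x)/h(v̄C,x)`;
`τ(x|ū,v̄) = ρ₁·f(ū,x) + f(x,ū)·f(v̄,x) + ρ₃·f(x,v̄)`. -/
theorem summation_formula_N13 (c : ℂ) (hc : c ≠ 0) (a b : ℕ)
    (uC : Fin (a + 1) → ℂ) (uB : Fin a → ℂ)
    (vC : Fin (b + 1) → ℂ) (vB : Fin b → ℂ)
    (x ρ₁ ρ₃ : ℂ)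
    (huC : Function.Injective uC) (hvB : Function.Injective vB)
    (hCB : ∀ j k, uC j ≠ uB k) (hBC : ∀ j k, vB j ≠ vC k)
    (huC1 : ∀ j, uC j - x ≠ 0) (huC2 : ∀ j, uC j - x + c ≠ 0) (huC3 : ∀ j, x - uC j + c ≠ 0)
    (huB1 : ∀ j, uB j - x ≠ 0) (huB2 : ∀ j, uB j - x + c ≠ 0) (huB3 : ∀ j, x - uB j + c ≠ 0)
    (hvC1 : ∀ j, vC j - x ≠ 0) (hvC2 : ∀ j, vC j - x + c ≠ 0) (hvC3 : ∀ j, x - vC j + c ≠ 0)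
    (hvB1 : ∀ j, vB j - x ≠ 0) (hvB2 : ∀ j, vB j - x + c ≠ 0) (hvB3 : ∀ j, x - vB j + c ≠ 0) :
    (∑ j, ((∏ k ∈ univ.erase j, c / (uC j - uC k)) / ∏ k, c / (uC j - uB k)) *
        ((c ^ 2 / ((uC j - x) * (uC j - x + c))) *
            ((-1 : ℂ) ^ a * ρ₁ * (∏ k, (uC k - x + c) / c) /
              ((∏ k, (vC k - x + c) / (vC k - x)) * ∏ k, (x - uB k + c) / c))
          + (c ^ 2 / ((x - uC j) * (x - uC j + c))) *
              (∏ k, (x - uC k + c) / c) / ∏ k, (x - uB k + c) / c))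
    + ∑ j, (-((∏ k ∈ univ.erase j, c / (vB j - vB k)) / ∏ k, c / (vB j - vC k))) *
        ((c ^ 2 / ((x - vB j) * (x - vB j + c))) *
            ((-1 : ℂ) ^ (b + 1) * ρ₃ * (∏ k, (x - vB k + c) / c) /
              ((∏ k, (x - uB k + c) / (x - uB k)) * ∏ k, (vC k - x + c) / c))
          + (c ^ 2 / ((vB j - x) * (vB j - x + c))) *
              (∏ k, (vB k - x + c) / c) / ∏ k, (vC k - x + c) / c)
    = ((ρ₁ * (∏ k, (uC k - x + c) / (uC k - x))
          + (∏ k, (x - uC k + c) / (x - uC k)) * (∏ k, (vC k - x + c) / (vC k - x))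
          + ρ₃ * ∏ k, (x - vC k + c) / (x - vC k))
        - (ρ₁ * (∏ k, (uB k - x + c) / (uB k - x))
            + (∏ k, (x - uB k + c) / (x - uB k)) * (∏ k, (vB k - x + c) / (vB k - x))
            + ρ₃ * ∏ k, (x - vB k + c) / (x - vB k)))
        / ((∏ k, (x - uB k + c) / (x - uB k)) * ∏ k, (vC k - x + c) / (vC k - x))
    - ((-1 : ℂ) ^ (b + 1) * ρ₃ * (∏ k, (x - vB k + c) / c) /
          ((∏ k, (x - uB k + c) / (x - uB k)) * ∏ k, (vC k - x + c) / c)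
        + (∏ k, (vB k - x + c) / c) / ∏ k, (vC k - x + c) / c) := by
  have nz : ∀ {n : ℕ} (u : Fin n → ℂ), (∀ j, u j - x ≠ 0) → ∀ j, x - u j ≠ 0 := by
    intro n u h j h'; apply h j; rw [← neg_sub, h', neg_zero]
  have nm : ∀ {n : ℕ} (u : Fin n → ℂ), (∀ j, u j - x + c ≠ 0) → ∀ j, x - c - u j ≠ 0 := by
    intro n u h j h'; apply h j; linear_combination -h'
  have np : ∀ {n : ℕ} (u : Fin n → ℂ), (∀ j, x - u j + c ≠ 0) → ∀ j, x + c - u j ≠ 0 := by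
    intro n u h j h'; apply h j; linear_combination h'
  have pn : ∀ {n : ℕ} (y : ℂ) (u : Fin n → ℂ), (∀ j, y - u j ≠ 0) → ∏ j, (y - u j) ≠ 0 := by
    intro n y u h; exact prod_ne_zero_iff.2 fun k _ => h k
  obtain ⟨d, hd⟩ := pf_two vB vC hvB
  -- the four sums
  have U1 := t_left c x uC (fun j => (∏ k, (uC j - uB k)) / ∏ k ∈ univ.erase j, (uC j - uC k))
    huC1 huC2
  have U2 := t_right c x uC (fun j => (∏ k, (uC j - uB k)) / ∏ k ∈ univ.erase j, (uC j - uC k))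
    huC1 huC3
  have V1 := t_left c x vB (fun j => (∏ k, (vB j - vC k)) / ∏ k ∈ univ.erase j, (vB j - vB k))
    hvB1 hvB2
  have V2 := t_right c x vB (fun j => (∏ k, (vB j - vC k)) / ∏ k ∈ univ.erase j, (vB j - vB k))
    hvB1 hvB3
  rw [pf_one uC uB huC _ (nm uC huC2), pf_one uC uB huC _ (nz uC huC1)] at U1
  rw [pf_one uC uB huC _ (nz uC huC1), pf_one uC uB huC _ (np uC huC3)] at U2
  rw [hd _ (nm vB hvB2), hd _ (nz vB hvB1)] at V1
  rw [hd _ (nz vB hvB1), hd _ (np vB hvB3)] at V2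
  have SU : ∀ A B D : ℂ, (∑ j, ((∏ k ∈ univ.erase j, c / (uC j - uC k)) / ∏ k, c / (uC j - uB k)) *
        ((c ^ 2 / ((uC j - x) * (uC j - x + c))) * A
          + (c ^ 2 / ((x - uC j) * (x - uC j + c))) * B / D))
      = c * ((∏ k, (x - c - uB k)) / ∏ k, (x - c - uC k)
            - (∏ k, (x - uB k)) / ∏ k, (x - uC k)) * A
        + c * ((∏ k, (x - uB k)) / ∏ k, (x - uC k)
            - (∏ k, (x + c - uB k)) / ∏ k, (x + c - uC k)) * (B / D) := by
    intro A B D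
    rw [← U1, ← U2, sum_mul, sum_mul, ← sum_add_distrib]
    refine sum_congr rfl fun j _ => ?_
    rw [om_u c hc]; ring
  have SV : ∀ A B D : ℂ,
      (∑ j, (-((∏ k ∈ univ.erase j, c / (vB j - vB k)) / ∏ k, c / (vB j - vC k))) *
        ((c ^ 2 / ((x - vB j) * (x - vB j + c))) * A
          + (c ^ 2 / ((vB j - x) * (vB j - x + c))) * B / D))
      = -(1/c^2) * (c * ((∏ k, (x - vC k)) / (∏ k, (x - vB k))
            - (∏ k, (x + c - vC k)) / (∏ k, (x + c - vB k)) + c)) * A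
        + -(1/c^2) * (c * ((∏ k, (x - c - vC k)) / (∏ k, (x - c - vB k))
            - (∏ k, (x - vC k)) / (∏ k, (x - vB k)) + c)) * (B / D) := by
    intro A B D
    have e1 : ∀ p q : ℂ, c * (p - q + c) = c * ((p - x - d) - (q - (x + c) - d)) := by
      intro p q; ring
    have e2 : ∀ p q : ℂ, c * (p - q + c) = c * ((p - (x - c) - d) - (q - x - d)) := by
      intro p q; ring
    rw [e1, e2, ← V1, ← V2, mul_sum, mul_sum, sum_mul, sum_mul, ← sum_add_distrib]
    refine sum_congr rfl fun j _ => ?_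
    rw [om_v c hc]; ring
  rw [SU, SV]
  simp only [prod_div_distrib, pnegc, pneg, pposc, prod_const, card_univ, Fintype.card_fin]
  have a0 := pn _ _ (nz uC huC1)
  have a1 := pn _ _ (nm uC huC2)
  have a2 := pn _ _ (np uC huC3)
  have b0 := pn _ _ (nz uB huB1)
  have b1 := pn _ _ (nm uB huB2)
  have b2 := pn _ _ (np uB huB3)
  have c0 := pn _ _ (nz vC hvC1)
  have c1 := pn _ _ (nm vC hvC2)
  have c2 := pn _ _ (np vC hvC3)
  have d0 := pn _ _ (nz vB hvB1)
  have d1 := pn _ _ (nm vB hvB2)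
  have d2 := pn _ _ (np vB hvB3)
  generalize ∏ k, (x - uC k) = A0 at *
  generalize ∏ k, (x - c - uC k) = A1 at *
  generalize ∏ k, (x + c - uC k) = A2 at *
  generalize ∏ k, (x - uB k) = B0 at *
  generalize ∏ k, (x - c - uB k) = B1 at *
  generalize ∏ k, (x + c - uB k) = B2 at *
  generalize ∏ k, (x - vC k) = C0 at *
  generalize ∏ k, (x - c - vC k) = C1 at *
  generalize ∏ k, (x + c - vC k) = C2 at *
  generalize ∏ k, (x - vB k) = D0 at *
  generalize ∏ k, (x - c - vB k) = D1 at *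
  generalize ∏ k, (x + c - vB k) = D2 at *
  clear SU SV U1 U2 V1 V2 hd
  have hea : ((-1:ℂ)^a) = 1 ∨ ((-1:ℂ)^a) = -1 := neg_one_pow_eq_or ℂ a
  have heb : ((-1:ℂ)^b) = 1 ∨ ((-1:ℂ)^b) = -1 := neg_one_pow_eq_or ℂ b
  have hca : c ^ a ≠ 0 := pow_ne_zero _ hc
  have hcb : c ^ b ≠ 0 := pow_ne_zero _ hc
  simp only [pow_succ (-1 : ℂ), pow_succ c a, pow_succ c b]
  generalize c ^ a = ca at *
  generalize c ^ b = cb at *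
  generalize (-1 : ℂ) ^ a = ea at *
  generalize (-1 : ℂ) ^ b = eb at *
  rcases hea with rfl | rfl <;> rcases heb with rfl | rfl <;> field_simp <;> ring
end

section
/- Removable singularity of the diagonal matrix element (equation (6.11) of the paper): suppose the Bethe-type equation r₃(w) = f(v̄B,w)·f(w,ūB)/f(w,v̄B) holds. Then the function F(s) = g(s,w)·(−1)^b·r₃(s)·h(s,v̄B)/(f(s,ūB)·h(v̄C',s)) + g(w,s)·h(v̄B,s)/h(v̄C',s) has a removable singularity at s = w, and lim_{s→w} F(s) = c·(h(v̄B,w)/h(v̄C',w))·[ r₃'(w)/r₃(w) − Σ_{i=1}^{b} 2c/((w − v^B_i)² − c²) + (1/c)·Σ_{j=1}^{a} t(w,u^B_j) ]. -/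
open Filter Topology

theorem aux_prod {n : ℕ} (f : Fin n → ℂ → ℂ) (l : Fin n → ℂ) (w : ℂ)
    (h : ∀ i, HasDerivAt (f i) (f i w * l i) w) :
    HasDerivAt (fun s => ∏ i, f i s) ((∏ i, f i w) * ∑ i, l i) w := by
  induction n with
  | zero => simpa using hasDerivAt_const w (1 : ℂ)
  | succ n ih =>
    have h1 := (h 0).mul (ih (fun i => f i.succ) (fun i => l i.succ) (fun i => h i.succ))
    simp only [Fin.prod_univ_succ, Fin.sum_univ_succ]
    refine h1.congr_deriv ?_
    ring

/-- Removable singularity of the diagonal matrix element (eq. (6.11)).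
Suppose the Bethe-type equation `r₃(w) = f(v̄B,w)·f(w,ūB)/f(w,v̄B)` holds. Then
`F(s) = g(s,w)·(−1)^b·r₃(s)·h(s,v̄B)/(f(s,ūB)·h(v̄C',s)) + g(w,s)·h(v̄B,s)/h(v̄C',s)`
has a removable singularity at `s = w`, with
`lim_{s→w} F(s) = c·(h(v̄B,w)/h(v̄C',w))·[ r₃'(w)/r₃(w) − Σ_{i} 2c/((w − v^B_i)² − c²)
  + (1/c)·Σ_{j} t(w,u^B_j) ]`.
Here `g(x,y) = c/(x−y)`, `f(x,y) = (x−y+c)/(x−y)`, `h(x,y) = (x−y+c)/c`,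
`t(x,y) = c²/((x−y)(x−y+c))`. -/
theorem removable_singularity_diagonal (c : ℂ) (hc : c ≠ 0) (a b : ℕ)
    (uB : Fin a → ℂ) (vB : Fin b → ℂ) (vC' : Fin b → ℂ) (w : ℂ)
    (hw1 : ∀ j, w - uB j ≠ 0) (hw2 : ∀ j, w - uB j + c ≠ 0)
    (hw3 : ∀ i, w - vB i ≠ 0) (hw4 : ∀ i, w - vB i + c ≠ 0) (hw5 : ∀ i, w - vB i - c ≠ 0)
    (hw6 : ∀ i, vC' i - w + c ≠ 0)
    (r₃ : ℂ → ℂ) (r₃' : ℂ) (hder : HasDerivAt r₃ r₃' w) (hr₃w : r₃ w ≠ 0)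
    (hBethe : r₃ w = (∏ i, (vB i - w + c) / (vB i - w)) *
        (∏ j, (w - uB j + c) / (w - uB j)) / ∏ i, (w - vB i + c) / (w - vB i)) :
    Tendsto (fun s : ℂ =>
        (c / (s - w)) * ((-1 : ℂ) ^ b * r₃ s * (∏ i, (s - vB i + c) / c) /
            ((∏ j, (s - uB j + c) / (s - uB j)) * ∏ i, (vC' i - s + c) / c))
          + (c / (w - s)) * (∏ i, (vB i - s + c) / c) / ∏ i, (vC' i - s + c) / c)
      (𝓝[≠] w)
      (𝓝 (c * ((∏ i, (vB i - w + c) / c) / ∏ i, (vC' i - w + c) / c) *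
        (r₃' / r₃ w - (∑ i, 2 * c / ((w - vB i) ^ 2 - c ^ 2))
          + (1 / c) * ∑ j, c ^ 2 / ((w - uB j) * (w - uB j + c))))) := by
  have hP := aux_prod (fun i s => (s - vB i + c) / c) (fun i => 1 / (w - vB i + c)) w (by
    intro i
    refine ((((hasDerivAt_id w).sub_const (vB i)).add_const c).div_const c).congr_deriv ?_
    have := hw4 i
    field_simp)
  have hH := aux_prod (fun i s => (vB i - s + c) / c) (fun i => 1 / (w - vB i - c)) w (by
    intro i
    refine ((((hasDerivAt_id w).const_sub (vB i)).add_const c).div_const c).congr_deriv ?_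
    have := hw5 i
    field_simp
    ring)
  have hU := aux_prod (fun j s => (s - uB j + c) / (s - uB j))
    (fun j => - (c / ((w - uB j) * (w - uB j + c)))) w (by
    intro j
    have h1 := hw1 j
    have h2 := hw2 j
    refine ((((hasDerivAt_id w).sub_const (uB j)).add_const c).div
      ((hasDerivAt_id w).sub_const (uB j)) h1).congr_deriv ?_
    simp only [id]
    field_simp
    ring)
  have hU0 : (∏ j, (w - uB j + c) / (w - uB j)) ≠ 0 :=
    Finset.prod_ne_zero_iff.2 fun j _ => div_ne_zero (hw2 j) (hw1 j)
  have hC0 : (∏ i, (vC' i - w + c) / c) ≠ 0 :=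
    Finset.prod_ne_zero_iff.2 fun j _ => div_ne_zero (hw6 j) hc
  have hCc : ContinuousAt (fun s : ℂ => ∏ i, (vC' i - s + c) / c) w := by
    fun_prop
  have hN := ((hder.const_mul ((-1 : ℂ) ^ b)).mul hP).div hU hU0
  have key : (-1 : ℂ) ^ b * r₃ w * (∏ i, (w - vB i + c) / c) /
      (∏ j, (w - uB j + c) / (w - uB j)) = ∏ i, (vB i - w + c) / c := by
    have e1 : (∏ i, (vB i - w + c) / c) = (-1 : ℂ) ^ b * ((∏ i, (vB i - w + c) / (vB i - w)) /
        (∏ i, (w - vB i + c) / (w - vB i))) * (∏ i, (w - vB i + c) / c) := by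
      have : (-1 : ℂ) ^ b = ∏ _i : Fin b, (-1 : ℂ) := by simp
      rw [this, ← Finset.prod_div_distrib, ← Finset.prod_mul_distrib, ← Finset.prod_mul_distrib]
      refine Finset.prod_congr rfl fun i _ => ?_
      have h3 := hw3 i
      have h4 := hw4 i
      have h5 : vB i - w ≠ 0 := by
        intro h
        apply h3
        linear_combination -h
      field_simp
      ring
    rw [e1, hBethe]
    field_simp
  have hG := hN.sub hH
  have hsl := (hasDerivAt_iff_tendsto_slope.1 hG)
  have hlim := (hsl.const_mul c).div (hCc.tendsto.mono_left nhdsWithin_le_nhds) hC0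
  have hsum : (∑ i, 2 * c / ((w - vB i) ^ 2 - c ^ 2)) =
      (∑ i, 1 / (w - vB i - c)) - ∑ i, 1 / (w - vB i + c) := by
    rw [← Finset.sum_sub_distrib]
    refine Finset.sum_congr rfl fun i _ => ?_
    have h4 := hw4 i
    have h5 := hw5 i
    have : (w - vB i) ^ 2 - c ^ 2 = (w - vB i - c) * (w - vB i + c) := by ring
    rw [this]
    field_simp
    ring
  have hsum2 : (1 / c) * (∑ j, c ^ 2 / ((w - uB j) * (w - uB j + c))) =
      - ∑ j, - (c / ((w - uB j) * (w - uB j + c))) := by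
    rw [Finset.mul_sum, ← Finset.sum_neg_distrib]
    refine Finset.sum_congr rfl fun i _ => ?_
    have h4 := hw1 i
    have h5 := hw2 i
    field_simp
  rw [hsum, hsum2]
  convert hlim.congr' ?_ using 2
  · rw [← key]
    generalize (∑ j, - (c / ((w - uB j) * (w - uB j + c)))) = S1
    generalize (∑ i, 1 / (w - vB i - c)) = S2
    generalize (∑ i, 1 / (w - vB i + c)) = S3
    simp only [Pi.mul_apply]
    generalize (∏ j, (w - uB j + c) / (w - uB j)) = U at *
    generalize (∏ i, (vC' i - w + c) / c) = C at *
    generalize (∏ i, (w - vB i + c) / c) = P at *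
    field_simp
    ring
  · filter_upwards [self_mem_nhdsWithin] with s hs
    have hs' : s - w ≠ 0 := sub_ne_zero.2 hs
    have e : w - s = - (s - w) := by ring
    simp only [slope_def_field, Pi.mul_apply, Pi.sub_apply, Pi.div_apply, Pi.smul_apply]
    rw [key, e, sub_self, sub_zero, div_neg]
    rw [← div_div ((-1 : ℂ) ^ b * r₃ s * _)]
    ring
end
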